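/- arXiv:0909.0431 — 3 statements merged into one kernel-verified Lean document; each statement's English description precedes it below -/
import Mathlib

section
/- Let G₁ be a k₁-regular simple graph on n₁ ≥ 1 vertices with adjacency matrix A₁ and G₂ a k₂-regular simple graph on n₂ ≥ 1 vertices with adjacency matrix A₂. Fix real weights μ₁, η₁, μ₂, η₂ and set κ₁ = μ₁ + η₁k₁, κ₂ = μ₂ + η₂k₂, δ = κ₁ − κ₂, Δ = √(δ² + 4n₁n₂), and α_± = (δ ± Δ)/(2n₁). Let M be the join Hamiltonian [[μ₁I + η₁A₁, J],[Jᵀ, μ₂I + η₂A₂]] with J the n₁×n₂ all-ones matrix. Then for each sign ±, the concatenated vector (α_±·1_{n₁}, 1_{n₂}), consisting of n₁ entries equal to α_± followed by n₂ entries equal to 1, is an eigenvector of M with eigenvalue n₁α_± + κ₂. -/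
open Matrix

/-- A weighted regular graph acts on constant vectors by its weighted degree. -/
theorem weighted_adjMatrix_mulVec_const {V : Type*} [Fintype V] [DecidableEq V]
    (G : SimpleGraph V) [DecidableRel G.Adj] {k : ℕ} (hG : G.IsRegularOfDegree k)
    (μ η a : ℝ) :
    (μ • (1 : Matrix V V ℝ) + η • G.adjMatrix ℝ) *ᵥ (fun _ => a) =
      fun _ => (μ + η * k) * a := by
  ext v
  have hadj : (G.adjMatrix ℝ *ᵥ fun _ => a) v = k * a := by
    simp [SimpleGraph.adjMatrix_mulVec_apply, hG.degree_eq v]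
  simp only [add_mulVec, smul_mulVec, one_mulVec, Pi.add_apply, Pi.smul_apply, hadj, smul_eq_mul]
  ring

/-- The `α₊`/`α₋` eigenvectors of the join Hamiltonian of two weighted regular graphs:
the vector with `n₁` entries equal to `α_±` followed by `n₂` entries equal to `1`
is an eigenvector with eigenvalue `n₁·α_± + κ₂`. -/
theorem join_plus_minus_eigenvectors
    (n₁ n₂ k₁ k₂ : ℕ) (hn₁ : 1 ≤ n₁) (hn₂ : 1 ≤ n₂)
    (G₁ : SimpleGraph (Fin n₁)) [DecidableRel G₁.Adj] (hG₁ : G₁.IsRegularOfDegree k₁)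
    (G₂ : SimpleGraph (Fin n₂)) [DecidableRel G₂.Adj] (hG₂ : G₂.IsRegularOfDegree k₂)
    (μ₁ η₁ μ₂ η₂ κ₁ κ₂ δ Δ : ℝ)
    (hκ₁ : κ₁ = μ₁ + η₁ * k₁) (hκ₂ : κ₂ = μ₂ + η₂ * k₂)
    (hδ : δ = κ₁ - κ₂) (hΔ : Δ = Real.sqrt (δ ^ 2 + 4 * n₁ * n₂))
    (M : Matrix (Fin n₁ ⊕ Fin n₂) (Fin n₁ ⊕ Fin n₂) ℝ)
    (hM : M = Matrix.fromBlocks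
      (μ₁ • 1 + η₁ • G₁.adjMatrix ℝ) (Matrix.of fun _ _ => 1)
      (Matrix.of fun _ _ => 1) (μ₂ • 1 + η₂ • G₂.adjMatrix ℝ)) :
    ∀ s : ℝ, s = 1 ∨ s = -1 →
      ∀ α : ℝ, α = (δ + s * Δ) / (2 * n₁) →
        M *ᵥ Sum.elim (fun _ => α) (fun _ => (1 : ℝ)) =
          (n₁ * α + κ₂) • Sum.elim (fun _ => α) (fun _ => (1 : ℝ)) := by
  intro s hs α hα
  have hn : (n₁ : ℝ) ≠ 0 := by positivity
  have hΔ_sq : Δ ^ 2 = δ ^ 2 + 4 * n₁ * n₂ := by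
    rw [hΔ, Real.sq_sqrt (by positivity)]
  have hs_sq : s ^ 2 = 1 := by rcases hs with rfl | rfl <;> norm_num
  have hlin : 2 * n₁ * α - δ = s * Δ := by
    rw [hα]
    field_simp
    ring
  have hquad : n₁ * α ^ 2 = δ * α + n₂ := by
    have hsq : (2 * n₁ * α - δ) ^ 2 = δ ^ 2 + 4 * n₁ * n₂ := by
      rw [hlin, mul_pow, hs_sq, hΔ_sq, one_mul]
    apply mul_left_cancel₀ hn
    linarith
  rw [hM, fromBlocks_mulVec]
  simp only [Sum.elim_comp_inl, Sum.elim_comp_inr]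
  rw [weighted_adjMatrix_mulVec_const G₁ hG₁, weighted_adjMatrix_mulVec_const G₂ hG₂,
    ← hκ₁, ← hκ₂]
  ext (i | i)
  · simp only [mulVec, dotProduct, Sum.elim_inl, Pi.add_apply, Pi.smul_apply, of_apply, mul_one,
      Finset.sum_const, Finset.card_univ, Fintype.card_fin, nsmul_eq_mul, smul_eq_mul]
    rw [hδ] at hquad
    linarith
  · simp [mulVec, dotProduct]
end

section
/- Let G be a k-regular simple graph on n ≥ 1 vertices with adjacency matrix A_G, let μ, η, κ, τ, ρ be real and ε ≠ 0, and let 𝒜 be the double half-cone Hamiltonian of size 2+2n: 𝒜[a,a] = 𝒜[b,b] = μ, 𝒜[a,b] = η, vertex a joined with weight ε to each vertex of the first copy of G, vertex b joined with weight ε to each vertex of the second copy, each copy carrying the block κI + τA_G, and the two copies joined completely with weight ρ. Set δ_α = (μ+η) − (κ + τk + ρn), Δ_α = √(δ_α² + 4ε²n) and α_± = (δ_α ± Δ_α)/(2ε). Then for each sign ±, the vector (α_±, α_±, 1_n, 1_n), with first two entries α_± followed by 2n entries equal to 1, is an eigenvector of 𝒜 with eigenvalue (δ_α ± Δ_α)/2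 + (κ + τk + ρn). -/
open Matrix

/-- The `α_±` eigenvectors `(α_±, α_±, 1_n, 1_n)` of the double half-cone Hamiltonian,
with eigenvalues `(δ_α ± Δ_α)/2 + (κ + τk + ρn)`. -/
theorem double_half_cone_alpha_eigenvectors
    (n k : ℕ) (hn : 1 ≤ n)
    (G : SimpleGraph (Fin n)) [DecidableRel G.Adj] (hG : G.IsRegularOfDegree k)
    (μ η κ τ ρ ε : ℝ) (hε : ε ≠ 0)
    (B : Matrix (Fin 2) (Fin n ⊕ Fin n) ℝ)
    (hB : B = Matrix.of fun i => Sum.elim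
      (fun _ => if i = 0 then ε else 0)
      (fun _ => if i = 1 then ε else 0))
    (𝒜 : Matrix (Fin 2 ⊕ (Fin n ⊕ Fin n)) (Fin 2 ⊕ (Fin n ⊕ Fin n)) ℝ)
    (h𝒜 : 𝒜 = Matrix.fromBlocks
      (!![μ, η; η, μ]) B Bᵀ
      (Matrix.fromBlocks
        (κ • 1 + τ • G.adjMatrix ℝ) (ρ • Matrix.of fun _ _ => 1)
        (ρ • Matrix.of fun _ _ => 1) (κ • 1 + τ • G.adjMatrix ℝ)))
    (δα Δα : ℝ)
    (hδα : δα = (μ + η) - (κ + τ * k + ρ * n))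
    (hΔα : Δα = Real.sqrt (δα ^ 2 + 4 * ε ^ 2 * n)) :
    ∀ s : ℝ, s = 1 ∨ s = -1 →
      ∀ α : ℝ, α = (δα + s * Δα) / (2 * ε) →
        𝒜 *ᵥ Sum.elim ![α, α] (Sum.elim (fun _ => (1 : ℝ)) (fun _ => (1 : ℝ))) =
          ((δα + s * Δα) / 2 + (κ + τ * k + ρ * n)) •
            Sum.elim ![α, α] (Sum.elim (fun _ => (1 : ℝ)) (fun _ => (1 : ℝ))) := by
  intro s hs α hα
  have hΔ : Δα ^ 2 = δα ^ 2 + 4 * ε ^ 2 * n := by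
    rw [hΔα, Real.sq_sqrt (by positivity)]
  have hs2 : s ^ 2 = 1 := by rcases hs with rfl | rfl <;> norm_num
  have he : (δα + s * Δα) / 2 = ε * α := by rw [hα]; field_simp
  have hquad : δα * α + ε * n = ε * α ^ 2 := by
    refine mul_left_cancel₀ hε ?_
    have hsΔ : s * Δα = 2 * (ε * α) - δα := by linarith
    have hsq : (2 * (ε * α) - δα) ^ 2 = δα ^ 2 + 4 * ε ^ 2 * n := by
      rw [← hsΔ, mul_pow, hs2, one_mul, hΔ]
    linarith
  have hrow (i : Fin n) : ∑ j, (κ • (1 : Matrix (Fin n) (Fin n) ℝ) + τ • G.adjMatrix ℝ) i j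
      = κ + τ * k := by
    have hadj : ∑ j, G.adjMatrix ℝ i j = k := by
      simpa [mulVec, dotProduct, hG i] using
        G.adjMatrix_mulVec_const_apply (a := (1 : ℝ)) (v := i)
    simp only [Matrix.add_apply, Matrix.smul_apply, smul_eq_mul, Finset.sum_add_distrib,
      ← Finset.mul_sum, hadj]
    simp [Matrix.one_apply]
  rw [he, h𝒜, hB]
  funext i
  rcases i with i | i | i
  · fin_cases i <;> simp [mulVec, dotProduct, Fin.sum_univ_two] <;>
      linear_combination hquad - α * hδα
  · simp only [mulVec, dotProduct, Fintype.sum_sum_type, fromBlocks_apply₂₁, fromBlocks_apply₂₂,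
      fromBlocks_apply₁₁, fromBlocks_apply₁₂, Sum.elim_inl, Sum.elim_inr, mul_one, hrow]
    simp
    ring
  · simp only [mulVec, dotProduct, Fintype.sum_sum_type, fromBlocks_apply₂₁, fromBlocks_apply₂₂,
      Sum.elim_inl, Sum.elim_inr, mul_one, hrow]
    simp
    ring
end

section
/- Let G be a k-regular simple graph on n ≥ 1 vertices with adjacency matrix A_G, let μ, η, κ, τ, ρ be real and ε ≠ 0, and let 𝒜 be the double half-cone Hamiltonian of size 2+2n: 𝒜[a,a] = 𝒜[b,b] = μ, 𝒜[a,b] = η, vertex a joined with weight ε to each vertex of the first copy of G, vertex b joined with weight ε to each vertex of the second copy, each copy carrying the block κI + τA_G, and the two copies joined completely with weight ρ. Set δ_β = (μ−η) − (κ + τk − ρn), Δ_β = √(δ_β² + 4ε²n) and β_± = (δ_β ± Δ_β)/(2ε). Then for each sign ±, the vector (β_±, −β_±, 1_n, −1_n), with first two entries β_±, −β_± followed by n entries equal to 1 and n entries equal to −1, is an eigenvector of 𝒜 with eigenvalue (δ_β ± Δ_β)/2 + (κ + τk − ρn). -/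
open Matrix

/-- The `β_±` eigenvectors `(β_±, −β_±, 1_n, −1_n)` of the double half-cone Hamiltonian,
with eigenvalues `(δ_β ± Δ_β)/2 + (κ + τk − ρn)`. -/
theorem double_half_cone_beta_eigenvectors
    (n k : ℕ) (hn : 1 ≤ n)
    (G : SimpleGraph (Fin n)) [DecidableRel G.Adj] (hG : G.IsRegularOfDegree k)
    (μ η κ τ ρ ε : ℝ) (hε : ε ≠ 0)
    (B : Matrix (Fin 2) (Fin n ⊕ Fin n) ℝ)
    (hB : B = Matrix.of fun i => Sum.elim
      (fun _ => if i = 0 then ε else 0)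
      (fun _ => if i = 1 then ε else 0))
    (𝒜 : Matrix (Fin 2 ⊕ (Fin n ⊕ Fin n)) (Fin 2 ⊕ (Fin n ⊕ Fin n)) ℝ)
    (h𝒜 : 𝒜 = Matrix.fromBlocks
      (!![μ, η; η, μ]) B Bᵀ
      (Matrix.fromBlocks
        (κ • 1 + τ • G.adjMatrix ℝ) (ρ • Matrix.of fun _ _ => 1)
        (ρ • Matrix.of fun _ _ => 1) (κ • 1 + τ • G.adjMatrix ℝ)))
    (δβ Δβ : ℝ)
    (hδβ : δβ = (μ - η) - (κ + τ * k - ρ * n))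
    (hΔβ : Δβ = Real.sqrt (δβ ^ 2 + 4 * ε ^ 2 * n)) :
    ∀ s : ℝ, s = 1 ∨ s = -1 →
      ∀ β : ℝ, β = (δβ + s * Δβ) / (2 * ε) →
        𝒜 *ᵥ Sum.elim ![β, -β] (Sum.elim (fun _ => (1 : ℝ)) (fun _ => (-1 : ℝ))) =
          ((δβ + s * Δβ) / 2 + (κ + τ * k - ρ * n)) •
            Sum.elim ![β, -β] (Sum.elim (fun _ => (1 : ℝ)) (fun _ => (-1 : ℝ))) := by
  intro s hs β hβ
  have hroot : ε * β = (δβ + s * Δβ) / 2 := by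
    rw [hβ]; field_simp
  have hΔsq : Δβ ^ 2 = δβ ^ 2 + 4 * ε ^ 2 * n := by
    rw [hΔβ, Real.sq_sqrt (by positivity)]
  have hssq : s ^ 2 = 1 := by rcases hs with rfl | rfl <;> norm_num
  have hquad : ε * β ^ 2 = δβ * β + ε * n := by
    have hsq : (2 * (ε * β) - δβ) ^ 2 = δβ ^ 2 + 4 * ε ^ 2 * n := by
      rw [hroot, ← hΔsq]
      linear_combination Δβ ^ 2 * hssq
    apply mul_left_cancel₀ hε
    linear_combination hsq / 4
  have hone : ∀ i, ∑ j, G.adjMatrix ℝ i j = k := fun i => by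
    simpa [mulVec, dotProduct] using
      G.adjMatrix_mulVec_const_apply_of_regular (a := (1 : ℝ)) hG (v := i)
  rw [← hroot, h𝒜, hB]
  ext i
  rcases i with i | i | i
  · fin_cases i
    · simp [mulVec, dotProduct, Fintype.sum_sum_type, Fin.sum_univ_two]
      linear_combination -hquad - β * hδβ
    · simp [mulVec, dotProduct, Fintype.sum_sum_type, Fin.sum_univ_two]
      linear_combination hquad + β * hδβ
  · simp [mulVec, dotProduct, Fintype.sum_sum_type, -SimpleGraph.adjMatrix_apply,
      Finset.sum_add_distrib, ← Finset.mul_sum, hone, Matrix.one_apply]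
    ring
  · simp [mulVec, dotProduct, Fintype.sum_sum_type, -SimpleGraph.adjMatrix_apply,
      Finset.sum_add_distrib, ← Finset.mul_sum, hone, Matrix.one_apply]
    ring
end
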